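/- arXiv:1202.2668 — 3 statements merged into one kernel-verified Lean document; each statement's English description precedes it below -/
import Mathlib

section
/- Let e ≥ 2, s ∈ ℤ^l and let λ be a nonempty l-partition such that ε_i(λ) = 0 for every i ∈ ℤ/eℤ. Then (λ,s) is e-periodic, i.e. the symbol B(λ,s) admits an e-period. -/
/- Formalization of combinatorial notions from
   "A combinatorial decomposition of higher level Fock spaces"
   by N. Jacon and C. Lecouvey. -/

open scoped Classical

noncomputable section

namespace FockHW

/-- An `l`-partition, encoded by `P c i = λ^c_{i+1}` (`i` is the 0-based row index). -/
abbrev MP (l : ℕ) := Fin l → ℕ → ℕ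

/-- A multicharge `s ∈ ℤ^l`. -/
abbrev Charge (l : ℕ) := Fin l → ℤ

/-- `P` is a genuine `l`-partition: each component is a weakly decreasing,
eventually zero, sequence of nonnegative integers. -/
def IsLPartition {l : ℕ} (P : MP l) : Prop :=
  (∀ c, Antitone (P c)) ∧ ∀ c, ∃ N, ∀ i, N ≤ i → P c i = 0

/-- The empty `l`-partition. -/
def emptyMP (l : ℕ) : MP l := fun _ _ => 0

/-- The entry `B(λ,s)^c_{i+1} = λ^c_{i+1} - (i+1) + s_c + 1` of the symbol of `(λ,s)`. -/
def symb {l : ℕ} (P : MP l) (s : Charge l) (c : Fin l) (i : ℕ) : ℤ :=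
  (P c i : ℤ) - (i : ℤ) + s c

/-- `v` is an entry of the `c`-th row of the symbol of `(P,s)`. -/
def RowHas {l : ℕ} (P : MP l) (s : Charge l) (c : Fin l) (v : ℤ) : Prop :=
  ∃ i, symb P s c i = v

/-- `k` is the largest entry of the symbol of `(P,s)`. -/
def IsMaxEntry {l : ℕ} (P : MP l) (s : Charge l) (k : ℤ) : Prop :=
  (∃ c, RowHas P s c k) ∧ ∀ c v, RowHas P s c v → v ≤ k

/-- The data `(k, per)` is an `e`-period of the symbol of `(P,s)`:
`k` is the largest entry, the rows `per 0 ≥ per 1 ≥ …` carry the entries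
`k, k-1, …, k-e+1`, and no entry `k-t` occurs in a row strictly below `per t`. -/
def IsEPeriod {l : ℕ} (e : ℕ) (P : MP l) (s : Charge l) (k : ℤ) (per : Fin e → Fin l) : Prop :=
  IsMaxEntry P s k ∧ Antitone per ∧
  ∀ t : Fin e, RowHas P s (per t) (k - ((t : ℕ) : ℤ)) ∧
    ∀ d : Fin l, RowHas P s d (k - ((t : ℕ) : ℤ)) → per t ≤ d

/-- `(P,s)` is `e`-periodic. -/
def EPeriodic {l : ℕ} (e : ℕ) (P : MP l) (s : Charge l) : Prop :=
  ∃ k per, IsEPeriod e P s k per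

/-- `(P',s')` is obtained from `(P,s)` by deleting the `e`-period with data `(k, per)`:
rowwise, the entries of the new symbol are the old ones minus the period entries. -/
def DeletesToWith {l : ℕ} (e : ℕ) (P : MP l) (s : Charge l) (k : ℤ) (per : Fin e → Fin l)
    (P' : MP l) (s' : Charge l) : Prop :=
  IsEPeriod e P s k per ∧ IsLPartition P' ∧
  ∀ d : Fin l, {v : ℤ | RowHas P' s' d v} =
    {v : ℤ | RowHas P s d v} \ {v : ℤ | ∃ t : Fin e, per t = d ∧ v = k - ((t : ℕ) : ℤ)}

/-- `(P',s')` is obtained from `(P,s)` by deleting the `e`-period. -/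
def DeletesTo {l : ℕ} (e : ℕ) (P : MP l) (s : Charge l) (P' : MP l) (s' : Charge l) : Prop :=
  ∃ k per, DeletesToWith e P s k per P' s'

/-- One step of the map `(λ,s) ↦ (λ⁻,s⁻)`: delete the `e`-period if `(λ,s)` is
`e`-periodic, do nothing otherwise. -/
def DeleteStep {l : ℕ} (e : ℕ) (P : MP l) (s : Charge l) (P' : MP l) (s' : Charge l) : Prop :=
  (¬ EPeriodic e P s ∧ P' = P ∧ s' = s) ∨ DeletesTo e P s P' s'

/-- The set `T_{l,e}` of weakly increasing multicharges with spread at most `e-1`. -/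
def Tle (l e : ℕ) : Set (Charge l) :=
  {t | Monotone t ∧ ∀ c d : Fin l, t d - t c ≤ (e : ℤ) - 1}

/-- The peeling procedure applied to `(P,s)` terminates at `(∅,t)`:
there is a chain of `e`-period deletions from `(P,s)` to `(∅,t)` with `t ∈ T_{l,e}`,
not passing through any `(∅,t')` with `t' ∈ T_{l,e}` earlier (so `λ° = ∅`, `s° = t`). -/
def PeelChainTo {l : ℕ} (e : ℕ) (P : MP l) (s : Charge l) (t : Charge l) : Prop :=
  t ∈ Tle l e ∧ ∃ (n : ℕ) (g : ℕ → MP l × Charge l), g 0 = (P, s) ∧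
    (∀ m, m < n → ¬((g m).1 = emptyMP l ∧ (g m).2 ∈ Tle l e) ∧
      DeletesTo e (g m).1 (g m).2 (g (m+1)).1 (g (m+1)).2) ∧
    g n = (emptyMP l, t)

/-- `(P,s)` is totally periodic: the peeling procedure ends with the empty
`l`-partition and a multicharge in `T_{l,e}`. -/
def TotallyPeriodic {l : ℕ} (e : ℕ) (P : MP l) (s : Charge l) : Prop :=
  ∃ t, PeelChainTo e P s t

/-- Indicator (valued in `ℤ`) of an addable node of content `x` in component `c`. -/
def addA {l : ℕ} (P : MP l) (s : Charge l) (c : Fin l) (x : ℤ) : ℤ :=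
  if RowHas P s c x ∧ ¬ RowHas P s c (x + 1) then 1 else 0

/-- Indicator (valued in `ℤ`) of a removable node of content `x` in component `c`. -/
def remR {l : ℕ} (P : MP l) (s : Charge l) (c : Fin l) (x : ℤ) : ℤ :=
  if RowHas P s c (x + 1) ∧ ¬ RowHas P s c x then 1 else 0

/-- `#R - #A` on the suffix of the `j`-word (`e = ∞`) starting at the node of
content `j` in component `c0` (the `j`-word is ordered by decreasing component). -/
def suffInf {l : ℕ} (P : MP l) (s : Charge l) (j : ℤ) (c0 : Fin l) : ℤ :=
  ∑ c ∈ Finset.univ.filter (fun c : Fin l => c ≤ c0), (remR P s c j - addA P s c j)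

/-- `#A - #R` on the prefix of the `j`-word (`e = ∞`) ending at the node of
content `j` in component `c0`. -/
def prefInf {l : ℕ} (P : MP l) (s : Charge l) (j : ℤ) (c0 : Fin l) : ℤ :=
  ∑ c ∈ Finset.univ.filter (fun c : Fin l => c0 ≤ c), (addA P s c j - remR P s c j)

/-- `ε^∞_j(λ)`: the number of `R`'s in the reduced `j`-word of `λ` (`e = ∞`),
computed as the largest value of `#R - #A` over suffixes of the `j`-word. -/
def epsInf {l : ℕ} (P : MP l) (s : Charge l) (j : ℤ) : ℤ :=
  sSup (insert 0 {z : ℤ | ∃ c0, z = suffInf P s j c0})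

/-- `φ^∞_j(λ)`: the number of `A`'s in the reduced `j`-word of `λ` (`e = ∞`). -/
def phiInf {l : ℕ} (P : MP l) (s : Charge l) (j : ℤ) : ℤ :=
  sSup (insert 0 {z : ℤ | ∃ c0, z = prefInf P s j c0})

/-- The `sl∞`-weight `wt(λ,s)_∞ = Σ_j (φ^∞_j - ε^∞_j) Λ_j` of `(λ,s)`,
as a function giving the coordinate on each `Λ_j`. -/
def wtInf {l : ℕ} (P : MP l) (s : Charge l) : ℤ → ℤ :=
  fun j => phiInf P s j - epsInf P s j

/-- `#R - #A` on the suffix of the `i`-word (residues mod `e`) starting at the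
node of content `x0` in component `c0`. -/
def suffE {l : ℕ} (e : ℕ) (P : MP l) (s : Charge l) (i : ZMod e) (x0 : ℤ) (c0 : Fin l) : ℤ :=
  ∑ᶠ x : ℤ, if (x : ZMod e) = i then
      (if x0 < x then ∑ c : Fin l, (remR P s c x - addA P s c x)
       else if x = x0 then suffInf P s x c0 else 0)
    else 0

/-- `#A - #R` on the prefix of the `i`-word ending at the node of content `x0`
in component `c0`. -/
def prefE {l : ℕ} (e : ℕ) (P : MP l) (s : Charge l) (i : ZMod e) (x0 : ℤ) (c0 : Fin l) : ℤ :=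
  ∑ᶠ x : ℤ, if (x : ZMod e) = i then
      (if x < x0 then ∑ c : Fin l, (addA P s c x - remR P s c x)
       else if x = x0 then prefInf P s x c0 else 0)
    else 0

/-- `ε_i(λ)`: the number of `R`'s in the reduced `i`-word of `λ`, computed as the
largest value of `#R - #A` over suffixes of the `i`-word. -/
def epsE {l : ℕ} (e : ℕ) (P : MP l) (s : Charge l) (i : ZMod e) : ℤ :=
  sSup (insert 0 {z : ℤ | ∃ x0 c0, z = suffE e P s i x0 c0})

/-- `φ_i(λ)`: the number of `A`'s in the reduced `i`-word of `λ`. -/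
def phiE {l : ℕ} (e : ℕ) (P : MP l) (s : Charge l) (i : ZMod e) : ℤ :=
  sSup (insert 0 {z : ℤ | ∃ x0 c0, z = prefE e P s i x0 c0})

/-- The fundamental weight `Λ_{j0}` of `P_∞`, as a coordinate function. -/
def Lam (j0 : ℤ) : ℤ → ℤ := fun j => if j = j0 then 1 else 0

/-- The level-zero weight `ω_k = Λ_{k+1} - Λ_{k-e+1}`. -/
def omegaW (e : ℕ) (k : ℤ) : ℤ → ℤ := fun j => Lam (k + 1) j - Lam (k - (e : ℤ) + 1) j

/-- `Λ_{t,∞} = Λ_{t_0} + … + Λ_{t_{l-1}}`. -/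
def LamCh {l : ℕ} (t : Charge l) : ℤ → ℤ := fun j => ∑ c : Fin l, Lam (t c) j

/-- The node of content `x` in component `c` is the good addable `i`-node of `λ`:
it is addable, of residue `i`, and it is the leftmost node in the `i`-word at which
the prefix count `#A - #R` attains its maximum `φ_i(λ)` (equivalently it corresponds
to the rightmost `A` of the reduced `i`-word). -/
def IsGoodAddableE {l : ℕ} (e : ℕ) (P : MP l) (s : Charge l) (i : ZMod e)
    (x : ℤ) (c : Fin l) : Prop :=
  addA P s c x = 1 ∧ (x : ZMod e) = i ∧ prefE e P s i x c = phiE e P s i ∧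
  ∀ (x' : ℤ) (c' : Fin l), addA P s c' x' = 1 → (x' : ZMod e) = i →
    prefE e P s i x' c' = phiE e P s i → (x < x' ∨ (x = x' ∧ c' ≤ c))

/-- The node of content `x` in component `c` is the good addable `x`-node of `λ`
for the `e = ∞` structure. -/
def IsGoodAddableInf {l : ℕ} (P : MP l) (s : Charge l) (x : ℤ) (c : Fin l) : Prop :=
  addA P s c x = 1 ∧ prefInf P s x c = phiInf P s x ∧
  ∀ c' : Fin l, addA P s c' x = 1 → prefInf P s x c' = phiInf P s x → c' ≤ c

/-- One step of the `RA`-cancellation: the state is a reduced word `A^p R^q`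
(encoded `(p,q)`), and a new letter (`true` = `A`, `false` = `R`) is appended. -/
def reduceStep : ℕ × ℕ → Bool → ℕ × ℕ
  | (p, q), true => if q = 0 then (p + 1, 0) else (p, q - 1)
  | (p, q), false => (p, q + 1)

/-- The result `A^p R^q` of recursively deleting the factors `RA` in a word
(`true` = `A`, `false` = `R`). -/
def reduceRA (w : List Bool) : ℕ × ℕ := w.foldl reduceStep (0, 0)

/-- The word `u_j`: reading the entries `j` and `j+1` of the symbol, rows from
top to bottom, each row from right to left, encoding `j` by `A` and `j+1` by `R`. -/
def ujWord {l : ℕ} (P : MP l) (s : Charge l) (j : ℤ) : List Bool :=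
  ((List.finRange l).reverse.map (fun c =>
    (if RowHas P s c (j + 1) then [false] else []) ++
    (if RowHas P s c j then [true] else []))).flatten

/-- The word `u_i = u_{jlow} u_{jlow+e} u_{jlow+2e} ⋯` (truncated after `B` factors). -/
def uiWord {l : ℕ} (e : ℕ) (P : MP l) (s : Charge l) (jlow : ℤ) (B : ℕ) : List Bool :=
  ((List.range B).map (fun tt => ujWord P s (jlow + (tt : ℤ) * (e : ℤ)))).flatten

/-- `m` is admissible for the symbol of `(P,s)`: every row contains every integer `< m`. -/
def Admissible {l : ℕ} (P : MP l) (s : Charge l) (m : ℤ) : Prop :=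
  ∀ c, ∀ v : ℤ, v < m → RowHas P s c v

/-- The number of entries `≥ m` in row `c` of the symbol of `(P,s)`. -/
def nGE {l : ℕ} (P : MP l) (s : Charge l) (c : Fin l) (m : ℤ) : ℕ :=
  {i : ℕ | m ≤ symb P s c i}.ncard

/-- The symbol of `(P,s)` is semistandard: for every admissible `m` and every `j`,
the `j`-th smallest entry `≥ m` of row `c` is at least the `j`-th smallest entry
`≥ m` of row `c+1`, whenever both are defined. -/
def Semistandard {l : ℕ} (P : MP l) (s : Charge l) : Prop :=
  ∀ m : ℤ, Admissible P s m → ∀ c : Fin l, ∀ hc : (c : ℕ) + 1 < l, ∀ j : ℕ,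
    1 ≤ j → j ≤ nGE P s c m → j ≤ nGE P s ⟨(c : ℕ) + 1, hc⟩ m →
    symb P s ⟨(c : ℕ) + 1, hc⟩ (nGE P s ⟨(c : ℕ) + 1, hc⟩ m - j) ≤
      symb P s c (nGE P s c m - j)

/-- The box in row `c`, column `x`, belongs to the skew shape `u∖t`. -/
def InShape {l : ℕ} (u t : Charge l) (c : Fin l) (x : ℤ) : Prop := t c < x ∧ x ≤ u c

/-- `τ` is a skew (semistandard) tableau of shape `u∖t` (normalized by `0` outside
the shape): rows strictly increase from left to right, columns weakly increase
from top (row `l-1`) to bottom (row `0`). -/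
def IsSkewTableau {l : ℕ} (u t : Charge l) (τ : Fin l → ℤ → ℤ) : Prop :=
  (∀ c x, ¬ InShape u t c x → τ c x = 0) ∧
  (∀ c x, InShape u t c x → InShape u t c (x + 1) → τ c x < τ c (x + 1)) ∧
  (∀ (c : Fin l) (hc : (c : ℕ) + 1 < l) (x : ℤ),
    InShape u t c x → InShape u t ⟨(c : ℕ) + 1, hc⟩ x → τ ⟨(c : ℕ) + 1, hc⟩ x ≤ τ c x)

/-- The box `b` is read strictly before the box `b'` in the reading word of a skew
tableau (rows from top to bottom, right to left within each row). -/
def ReadBefore {l : ℕ} (b b' : Fin l × ℤ) : Prop :=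
  b'.1 < b.1 ∨ (b.1 = b'.1 ∧ b'.2 < b.2)

/-- `(M, q)` is the `e`-period of the skew tableau `τ` of shape `u∖t`:
`M` is the largest entry, `q k` is the last box in reading order with entry `M-k`,
and these boxes occur in increasing reading order. -/
def IsTabPeriod {l : ℕ} (e : ℕ) (u t : Charge l) (τ : Fin l → ℤ → ℤ) (M : ℤ)
    (q : Fin e → Fin l × ℤ) : Prop :=
  (∃ c x, InShape u t c x ∧ τ c x = M) ∧
  (∀ c x, InShape u t c x → τ c x ≤ M) ∧
  (∀ k : Fin e, InShape u t (q k).1 (q k).2 ∧ τ (q k).1 (q k).2 = M - ((k : ℕ) : ℤ) ∧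
    ∀ c x, InShape u t c x → τ c x = M - ((k : ℕ) : ℤ) → (c, x) ≠ q k →
      ReadBefore (c, x) (q k)) ∧
  ∀ (k : Fin e) (hk : (k : ℕ) + 1 < e), ReadBefore (q k) (q ⟨(k : ℕ) + 1, hk⟩)

/-- `(u',τ')` is obtained from the skew tableau `(u,τ)` (inner shape `t`) by deleting
the boxes of its `e`-period. -/
def TabDeletesTo {l : ℕ} (e : ℕ) (u t : Charge l) (τ : Fin l → ℤ → ℤ)
    (u' : Charge l) (τ' : Fin l → ℤ → ℤ) : Prop :=
  ∃ M q, IsTabPeriod e u t τ M q ∧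
    (∀ c : Fin l, u' c = u c - ((Finset.univ.filter (fun k : Fin e => (q k).1 = c)).card : ℤ)) ∧
    (∀ k : Fin e, u' (q k).1 < (q k).2) ∧
    τ' = fun c x => if InShape u' t c x then τ c x else 0

/-- The trivial tableau of shape `u∖t`: row `c` contains `t_c+1, …, u_c`. -/
def trivialTab {l : ℕ} (u t : Charge l) : Fin l → ℤ → ℤ :=
  fun c x => if InShape u t c x then x else 0

/-- The skew tableau `τ` of shape `u∖t` is totally `e`-periodic: iterated deletion of
`e`-periods (never stopping early at a trivial tableau with charge in `T_{l,e}`)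
empties the tableau. -/
def TabTotallyPeriodic {l : ℕ} (e : ℕ) (u t : Charge l) (τ : Fin l → ℤ → ℤ) : Prop :=
  ∃ (n : ℕ) (G : ℕ → Charge l × (Fin l → ℤ → ℤ)), G 0 = (u, τ) ∧
    (∀ m, m < n → ¬((G m).2 = trivialTab (G m).1 t ∧ (G m).1 ∈ Tle l e) ∧
      TabDeletesTo e (G m).1 t (G m).2 (G (m+1)).1 (G (m+1)).2) ∧
    (G n).1 = t

/-- The set `Tab^e_{u∖t}` of totally periodic skew tableaux of shape `u∖t`
(row `c` contains only integers `> t_c`). -/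
def TabSet {l : ℕ} (e : ℕ) (u t : Charge l) : Set (Fin l → ℤ → ℤ) :=
  {τ | IsSkewTableau u t τ ∧ (∀ c x, InShape u t c x → t c < τ c x) ∧
       TabTotallyPeriodic e u t τ}

/-- The `sl∞`-weight `wt(τ)_∞ = Σ_b ε_{τ(b)}` of a skew tableau, as a coordinate
function on the `Λ_j`. -/
def wtTab {l : ℕ} (u t : Charge l) (τ : Fin l → ℤ → ℤ) : ℤ → ℤ :=
  fun j => ({p : Fin l × ℤ | InShape u t p.1 p.2 ∧ τ p.1 p.2 = j - 1}.ncard : ℤ)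
         - ({p : Fin l × ℤ | InShape u t p.1 p.2 ∧ τ p.1 p.2 = j}.ncard : ℤ)

/-- `Tab^e_{u∖t,γ}`: totally periodic skew tableaux of shape `u∖t` and weight `γ`. -/
def TabSetWt {l : ℕ} (e : ℕ) (u t : Charge l) (γ : ℤ → ℤ) : Set (Fin l → ℤ → ℤ) :=
  {τ ∈ TabSet e u t | wtTab u t τ = γ}

/-- The level-`0` part `B(λ,s)_0` of a symbol: the skew tableau of shape `s∖t`
whose row `c` lists, in increasing order, the entries `> t_c` of row `c` of the
symbol of `(P,s)` (these are the entries deleted during the peeling when `s° = t`). -/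
def level0 {l : ℕ} (P : MP l) (s t : Charge l) : Fin l → ℤ → ℤ :=
  fun c x =>
    if t c < x ∧ x ≤ s c then
      sInf {u : ℤ | RowHas P s c u ∧ t c < u ∧
        ({v : ℤ | RowHas P s c v ∧ t c < v ∧ v ≤ u}.ncard : ℤ) = x - t c}
    else 0

/-- The Young diagram `λ(v)`: the conjugate of the partition
`(v_{l-1}-v_0, v_{l-2}-v_0, …, v_1-v_0)`, as a set of boxes `(row, column)`. -/
def lamShape {l : ℕ} (hl : 0 < l) (v : Charge l) : Set (ℕ × ℕ) :=
  {rc | rc.2 + 1 < l ∧ (rc.1 : ℤ) < v ⟨l - 1 - rc.2, by omega⟩ - v ⟨0, hl⟩}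

/-- The set of semistandard Young tableaux of shape `λ(v)` and weight
`μ(v) = (s_0 - v_0, …, s_{l-1} - v_0)`; its cardinality is the Kostka number
`K_{λ(v),μ(v)}`. -/
def KostkaSet {l : ℕ} (hl : 0 < l) (v s : Charge l) : Set (ℕ → ℕ → ℕ) :=
  {T | (∀ r c, (r, c) ∉ lamShape hl v → T r c = 0) ∧
       (∀ r c, (r, c) ∈ lamShape hl v → 1 ≤ T r c ∧ T r c ≤ l) ∧
       (∀ r c, (r, c) ∈ lamShape hl v → (r, c + 1) ∈ lamShape hl v → T r c ≤ T r (c + 1)) ∧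
       (∀ r c, (r, c) ∈ lamShape hl v → (r + 1, c) ∈ lamShape hl v → T r c < T (r + 1) c) ∧
       ∀ cc : Fin l,
         (({rc : ℕ × ℕ | rc ∈ lamShape hl v ∧ T rc.1 rc.2 = (cc : ℕ) + 1}.ncard : ℤ))
           = s cc - v ⟨0, hl⟩}

/-- `w` is a reverse lattice (Yamanouchi) word: it can be decomposed into disjoint
subwords of the form `a (a-1) (a-2) ⋯ min(w)`. -/
def IsReverseLatticeWord (w : List ℤ) : Prop :=
  w = [] ∨ ∃ mn : ℤ, mn ∈ w ∧ (∀ x ∈ w, mn ≤ x) ∧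
    ∃ (r : ℕ) (col : Fin w.length → Fin r) (a : Fin r → ℤ),
      (∀ p : Fin w.length,
        w.get p = a (col p) -
          ((Finset.univ.filter (fun q : Fin w.length => q < p ∧ col q = col p)).card : ℤ)) ∧
      ∀ jj : Fin r,
        ((Finset.univ.filter (fun p : Fin w.length => col p = jj)).card : ℤ) = a jj - mn + 1

/-- The word obtained by reading the entries `≥ m` of the symbol of `(P,s)`,
rows from top to bottom, each row from right to left (i.e. in decreasing order). -/
def readWordGE {l : ℕ} (P : MP l) (s : Charge l) (m : ℤ) : List ℤ :=
  ((List.finRange l).reverse.map (fun c =>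
     (List.range (nGE P s c m)).map (fun i => symb P s c i))).flatten


/-- The contribution of row `c` to `#R - #A` at content `x`. -/
theorem remR_sub_addA_eq {l : ℕ} (P : MP l) (s : Charge l) (c : Fin l) (x : ℤ) :
    remR P s c x - addA P s c x =
      (if RowHas P s c (x + 1) then 1 else 0) - (if RowHas P s c x then 1 else 0) := by
  unfold remR addA
  by_cases h₁ : RowHas P s c (x + 1) <;> by_cases h₂ : RowHas P s c x <;> simp [h₁, h₂]

theorem remR_sub_addA_le_one {l : ℕ} (P : MP l) (s : Charge l) (c : Fin l) (x : ℤ) :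
    remR P s c x - addA P s c x ≤ 1 := by
  rw [remR_sub_addA_eq]
  split_ifs <;> norm_num

theorem sum_remR_sub_addA_le {l : ℕ} (P : MP l) (s : Charge l) (F : Finset (Fin l)) (x : ℤ) :
    ∑ c ∈ F, (remR P s c x - addA P s c x) ≤ l :=
  calc ∑ c ∈ F, (remR P s c x - addA P s c x)
      ≤ ∑ _c ∈ F, (1 : ℤ) := Finset.sum_le_sum fun c _ => remR_sub_addA_le_one P s c x
    _ = (F.card : ℤ) := by simp
    _ ≤ l := by exact_mod_cast (Finset.card_le_univ F).trans_eq (Fintype.card_fin l)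

theorem remR_sub_addA_eq_zero_of_gt {l : ℕ} {P : MP l} {s : Charge l} {k x : ℤ}
    (hk : IsMaxEntry P s k) (hx : k < x) (c : Fin l) :
    remR P s c x - addA P s c x = 0 := by
  have h₁ : ¬ RowHas P s c (x + 1) := fun h => by linarith [hk.2 c _ h]
  have h₂ : ¬ RowHas P s c x := fun h => by linarith [hk.2 c _ h]
  simp [remR_sub_addA_eq, h₁, h₂]

theorem remR_sub_addA_eq_zero_of_lt {l : ℕ} {P : MP l} {s : Charge l} {m x : ℤ}
    (hm : Admissible P s m) (hx : x + 1 < m) (c : Fin l) :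
    remR P s c x - addA P s c x = 0 := by
  simp [remR_sub_addA_eq, hm c _ hx, hm c x (by linarith)]

theorem IsLPartition.exists_isMaxEntry {l : ℕ} {P : MP l} (hl : 0 < l) (hP : IsLPartition P)
    (s : Charge l) : ∃ k, IsMaxEntry P s k := by
  have : Nonempty (Fin l) := ⟨⟨0, hl⟩⟩
  obtain ⟨c, hc⟩ := Finite.exists_max fun c => symb P s c 0
  refine ⟨symb P s c 0, ⟨c, 0, rfl⟩, ?_⟩
  rintro d _ ⟨i, rfl⟩
  refine le_trans ?_ (hc d)
  have := hP.1 d (Nat.zero_le i)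
  unfold symb
  omega

theorem IsLPartition.exists_admissible {l : ℕ} {P : MP l} (hP : IsLPartition P)
    (s : Charge l) : ∃ m, Admissible P s m := by
  choose N hN using hP.2
  obtain ⟨m, hm⟩ := (Set.finite_range fun c => s c - (N c : ℤ)).bddBelow
  refine ⟨m, fun c v hv => ⟨(s c - v).toNat, ?_⟩⟩
  have hmc : m ≤ s c - N c := hm ⟨c, rfl⟩
  rw [symb, hN c _ (by omega)]
  omega

theorem suffE_le {l e : ℕ} {P : MP l} {s : Charge l} {k m : ℤ} (hk : IsMaxEntry P s k)
    (hm : Admissible P s m) (i : ZMod e) (x0 : ℤ) (c0 : Fin l) :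
    suffE e P s i x0 c0 ≤ (Finset.Icc (m - 1) k).card * l := by
  unfold suffE
  rw [finsum_eq_sum_of_support_subset (s := Finset.Icc (m - 1) k)]
  · rw [← nsmul_eq_mul]
    refine Finset.sum_le_card_nsmul _ _ _ fun x _ => ?_
    split_ifs
    · exact sum_remR_sub_addA_le P s _ x
    · exact sum_remR_sub_addA_le P s _ x
    all_goals exact Int.natCast_nonneg l
  · intro x hx
    by_contra hmem
    have hzero : ∀ c, remR P s c x - addA P s c x = 0 := by
      intro c
      rw [Finset.coe_Icc, Set.mem_Icc, not_and_or, not_le, not_le] at hmem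
      rcases hmem with h | h
      · exact remR_sub_addA_eq_zero_of_lt hm (by linarith) c
      · exact remR_sub_addA_eq_zero_of_gt hk h c
    exact hx (by simp [suffInf, hzero])

theorem suffE_le_epsE {l e : ℕ} {P : MP l} (hl : 0 < l) (hP : IsLPartition P)
    (s : Charge l) (i : ZMod e) (x0 : ℤ) (c0 : Fin l) :
    suffE e P s i x0 c0 ≤ epsE e P s i := by
  obtain ⟨k, hk⟩ := hP.exists_isMaxEntry hl s
  obtain ⟨m, hm⟩ := hP.exists_admissible s
  refine le_csSup ?_ (Set.mem_insert_of_mem _ ⟨x0, c0, rfl⟩)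
  refine BddAbove.insert 0 ⟨(Finset.Icc (m - 1) k).card * l, ?_⟩
  rintro _ ⟨x, c, rfl⟩
  exact suffE_le hk hm i x c

/-- Close to the largest entry, a suffix of the `i`-word only sees nodes of one content. -/
theorem suffE_eq_suffInf {l e : ℕ} {P : MP l} {s : Charge l} {k x : ℤ}
    (hk : IsMaxEntry P s k) (hx : k < x + e) (c : Fin l) :
    suffE e P s (x : ZMod e) x c = suffInf P s x c := by
  unfold suffE
  rw [finsum_eq_single _ x]
  · simp
  · intro y hy
    split_ifs with hyx hlt
    · refine Finset.sum_eq_zero fun d _ => remR_sub_addA_eq_zero_of_gt hk ?_ d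
      have hdvd : (e : ℤ) ∣ y - x := (ZMod.intCast_eq_intCast_iff_dvd_sub x y e).1 hyx.symm
      have := Int.le_of_dvd (by linarith) hdvd
      linarith
    · rfl
    · rfl

theorem exists_le_rowHas_of_epsE_eq_zero {l e : ℕ} {P : MP l} {s : Charge l} (hl : 0 < l)
    (hP : IsLPartition P) (hhw : ∀ i : ZMod e, epsE e P s i = 0) {k x : ℤ}
    (hk : IsMaxEntry P s k) (hx : k < x + e) {c : Fin l} (hc : RowHas P s c (x + 1)) :
    ∃ d ≤ c, RowHas P s d x := by
  by_contra! hno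
  have hle := suffE_le_epsE hl hP s (x : ZMod e) x c
  rw [hhw, suffE_eq_suffInf hk hx] at hle
  refine absurd hle (not_le.2 ?_)
  refine Finset.sum_pos' (fun d hd => ?_) ⟨c, by simp, ?_⟩
  · rw [remR_sub_addA_eq, if_neg (hno d (by simpa using hd))]
    split_ifs <;> norm_num
  · simp [remR_sub_addA_eq, hc, hno c le_rfl]

theorem exists_le_rowHas_sub_of_epsE_eq_zero {l e : ℕ} {P : MP l} {s : Charge l} (hl : 0 < l)
    (hP : IsLPartition P) (hhw : ∀ i : ZMod e, epsE e P s i = 0) {k : ℤ}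
    (hk : IsMaxEntry P s k) {t u : ℕ} (htu : t ≤ u) (hu : u < e) {c : Fin l}
    (hc : RowHas P s c (k - t)) : ∃ d ≤ c, RowHas P s d (k - u) := by
  induction u, htu using Nat.le_induction with
  | base => exact ⟨c, le_rfl, hc⟩
  | succ n _ ih =>
    obtain ⟨d, hdc, hd⟩ := ih (by omega)
    obtain ⟨d', hd', h⟩ := exists_le_rowHas_of_epsE_eq_zero hl hP hhw hk
      (x := k - (n + 1 : ℕ)) (c := d) (by omega) (by convert hd using 1; push_cast; ring)
    exact ⟨d', hd'.trans hdc, h⟩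

/-- a nonempty `l`-partition with `ε_i(λ) = 0` for all `i ∈ ℤ/eℤ`
admits an `e`-period. -/
theorem ePeriodic_of_highestWeight {l e : ℕ} (hl : 0 < l) (he : 2 ≤ e)
    (P : MP l) (s : Charge l) (hP : IsLPartition P) (hne : P ≠ emptyMP l)
    (hhw : ∀ i : ZMod e, epsE e P s i = 0) :
    EPeriodic e P s := by
  obtain ⟨k, hk⟩ := hP.exists_isMaxEntry hl s
  have hleast : ∀ t : Fin e, ∃ c, IsLeast {c | RowHas P s c (k - ((t : ℕ) : ℤ))} c := by
    intro t
    obtain ⟨c, hc⟩ := hk.1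
    obtain ⟨d, -, hd⟩ := exists_le_rowHas_sub_of_epsE_eq_zero hl hP hhw hk
      (Nat.zero_le t) t.isLt (c := c) (by simpa using hc)
    obtain ⟨b, hb⟩ := (Set.toFinite {c | RowHas P s c (k - ((t : ℕ) : ℤ))}).exists_minimal ⟨d, hd⟩
    exact ⟨b, hb.prop, fun a ha => (le_total b a).elim id fun h => hb.le_of_le ha h⟩
  choose per hper using hleast
  refine ⟨k, per, hk, fun t u htu => ?_, fun t => ⟨(hper t).1, fun d hd => (hper t).2 hd⟩⟩
  obtain ⟨d, hd, hdu⟩ := exists_le_rowHas_sub_of_epsE_eq_zero hl hP hhw hk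
    (Fin.le_def.1 htu) u.isLt (hper t).1
  exact ((hper u).2 hdu).trans hd

end FockHW
end
end

section
/- Let e ≥ 2, s ∈ ℤ^l, λ an l-partition, and let (λ⁻,s⁻) be obtained from (λ,s) by deleting the e-period of B(λ,s) if (λ,s) is e-periodic, and (λ⁻,s⁻) = (λ,s) otherwise. Then for every i ∈ ℤ/eℤ: ε_i(λ) = 0 (computed with respect to s) if and only if ε_i(λ⁻) = 0 (computed with respect to s⁻). -/
/- Formalization of combinatorial notions from
   "A combinatorial decomposition of higher level Fock spaces"
   by N. Jacon and C. Lecouvey. -/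

open scoped Classical

noncomputable section

namespace FockHW

/-- The number of rows of the symbol in `A` that contain the entry `x`. -/
def beadCount {l : ℕ} (P : MP l) (s : Charge l) (A : Finset (Fin l)) (x : ℤ) : ℤ :=
  ∑ c ∈ A, if RowHas P s c x then 1 else 0

/-- The rows whose node of content `x` belongs to the suffix starting at the node of
content `x0` in component `c0`. -/
def suffRows {l : ℕ} (x0 : ℤ) (c0 : Fin l) (x : ℤ) : Finset (Fin l) :=
  Finset.univ.filter (fun c => x0 < x ∨ x = x0 ∧ c ≤ c0)

/-- The contribution of the nodes of content `x` to `suffE e P s i x0 c0`. -/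
def suffTerm {l : ℕ} (e : ℕ) (P : MP l) (s : Charge l) (i : ZMod e) (x0 : ℤ) (c0 : Fin l)
    (x : ℤ) : ℤ :=
  if (x : ZMod e) = i then
    beadCount P s (suffRows x0 c0 x) (x + 1) - beadCount P s (suffRows x0 c0 x) x else 0

section

variable {l : ℕ} {P : MP l} {s : Charge l}

theorem beadCount_nonneg (A : Finset (Fin l)) (x : ℤ) : 0 ≤ beadCount P s A x :=
  Finset.sum_nonneg fun c _ => by split_ifs <;> simp

theorem beadCount_eq_zero {A : Finset (Fin l)} {x : ℤ} (h : ∀ c ∈ A, ¬ RowHas P s c x) :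
    beadCount P s A x = 0 :=
  Finset.sum_eq_zero fun c hc => by simp [h c hc]

theorem beadCount_le_card (A : Finset (Fin l)) (x : ℤ) : beadCount P s A x ≤ l := by
  calc beadCount P s A x ≤ ∑ c ∈ A, 1 :=
        Finset.sum_le_sum fun c _ => by split_ifs <;> simp
    _ = A.card := by simp
    _ ≤ l := by exact_mod_cast (Finset.card_le_univ A).trans_eq (Fintype.card_fin l)

theorem beadCount_empty (x : ℤ) : beadCount P s ∅ x = 0 := by simp [beadCount]

theorem sum_remR_sub_addA (A : Finset (Fin l)) (x : ℤ) :
    ∑ c ∈ A, (remR P s c x - addA P s c x) = beadCount P s A (x + 1) - beadCount P s A x := by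
  rw [beadCount, beadCount, ← Finset.sum_sub_distrib]
  refine Finset.sum_congr rfl fun c _ => ?_
  unfold remR addA
  by_cases h1 : RowHas P s c (x + 1) <;> by_cases h2 : RowHas P s c x <;> simp [h1, h2]

theorem suffRows_of_lt {x0 x : ℤ} (c0 : Fin l) (h : x0 < x) :
    suffRows x0 c0 x = Finset.univ := by
  simp [suffRows, h]

theorem suffRows_of_gt {x0 x : ℤ} (c0 : Fin l) (h : x < x0) : suffRows x0 c0 x = ∅ := by
  simp [suffRows, h.not_gt, h.ne]

theorem mem_suffRows_self {x0 : ℤ} {c0 c : Fin l} : c ∈ suffRows x0 c0 x0 ↔ c ≤ c0 := by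
  simp [suffRows]

theorem suffE_eq_finsum (e : ℕ) (i : ZMod e) (x0 : ℤ) (c0 : Fin l) :
    suffE e P s i x0 c0 = ∑ᶠ x, suffTerm e P s i x0 c0 x := by
  refine finsum_congr fun x => ?_
  unfold suffTerm suffInf
  rcases lt_trichotomy x0 x with h | rfl | h
  · simp only [h, if_true, suffRows_of_lt, sum_remR_sub_addA]
  · simp only [lt_irrefl, if_false, if_true, sum_remR_sub_addA]
    simp [suffRows]
  · simp [h.not_gt, h.ne, suffRows_of_gt c0 h, beadCount_empty]

theorem symb_le_symb_zero (hP : IsLPartition P) (c : Fin l) (j : ℕ) :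
    symb P s c j ≤ symb P s c 0 := by
  have := hP.1 c (Nat.zero_le j)
  unfold symb
  push_cast
  omega

/-- Outside a bounded window, each content carries either no entry or an entry in every row. -/
theorem exists_entry_bounds (hP : IsLPartition P) :
    ∃ a b : ℤ, (∀ x, x < a → ∀ c, RowHas P s c x) ∧ ∀ x, b < x → ∀ c, ¬ RowHas P s c x := by
  have h1 : ∀ᶠ a : ℤ in Filter.atBot, ∀ c, ∀ x, x < a → RowHas P s c x := by
    rw [Filter.eventually_all]
    intro c
    obtain ⟨N, hN⟩ := hP.2 c
    filter_upwards [Filter.eventually_le_atBot (s c - N)] with a ha x hx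
    refine ⟨(s c - x).toNat, ?_⟩
    have := hN (s c - x).toNat (by omega)
    unfold symb
    rw [this]
    push_cast
    omega
  have h2 : ∀ᶠ b : ℤ in Filter.atTop, ∀ c, ∀ x, b < x → ¬ RowHas P s c x := by
    rw [Filter.eventually_all]
    intro c
    filter_upwards [Filter.eventually_ge_atTop (symb P s c 0)] with b hb x hx
    rintro ⟨j, rfl⟩
    have := symb_le_symb_zero (s := s) hP c j
    omega
  obtain ⟨a, ha⟩ := h1.exists
  obtain ⟨b, hb⟩ := h2.exists
  exact ⟨a, b, fun x hx c => ha c x hx, fun x hx c => hb c x hx⟩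

theorem exists_support_suffTerm_subset (hP : IsLPartition P) (e : ℕ) (i : ZMod e) :
    ∃ a b : ℤ, ∀ x0 c0, Function.support (suffTerm e P s i x0 c0) ⊆ Finset.Icc a b := by
  obtain ⟨a, b, ha, hb⟩ := exists_entry_bounds (s := s) hP
  refine ⟨a - 1, b, fun x0 c0 x hx => ?_⟩
  rw [Finset.coe_Icc, Set.mem_Icc]
  by_contra hn
  apply hx
  have hx' : x + 1 < a ∨ b < x := by omega
  unfold suffTerm
  rcases hx' with h | h
  · simp [beadCount, ha (x + 1) h, ha x (by omega)]
  · simp [beadCount, hb (x + 1) (by omega), hb x h]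

theorem finite_support_suffTerm (hP : IsLPartition P) (e : ℕ) (i : ZMod e) (x0 : ℤ)
    (c0 : Fin l) : (Function.support (suffTerm e P s i x0 c0)).Finite := by
  obtain ⟨a, b, h⟩ := exists_support_suffTerm_subset (s := s) hP e i
  exact (Finset.finite_toSet _).subset (h x0 c0)

theorem suffTerm_le (e : ℕ) (i : ZMod e) (x0 : ℤ) (c0 : Fin l) (x : ℤ) :
    suffTerm e P s i x0 c0 x ≤ l := by
  unfold suffTerm
  split_ifs
  · have := beadCount_le_card (P := P) (s := s) (suffRows x0 c0 x) (x + 1)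
    have := beadCount_nonneg (P := P) (s := s) (suffRows x0 c0 x) x
    omega
  · positivity

theorem epsE_eq_zero_iff (hP : IsLPartition P) (e : ℕ) (i : ZMod e) :
    epsE e P s i = 0 ↔ ∀ x0 c0, suffE e P s i x0 c0 ≤ 0 := by
  have hbdd : BddAbove (insert 0 {z : ℤ | ∃ x0 c0, z = suffE e P s i x0 c0}) := by
    rw [bddAbove_insert]
    obtain ⟨a, b, h⟩ := exists_support_suffTerm_subset (s := s) hP e i
    refine ⟨∑ x ∈ Finset.Icc a b, (l : ℤ), ?_⟩
    rintro _ ⟨x0, c0, rfl⟩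
    rw [suffE_eq_finsum, finsum_eq_sum_of_support_subset _ (h x0 c0)]
    exact Finset.sum_le_sum fun x _ => suffTerm_le e i x0 c0 x
  constructor
  · intro h x0 c0
    rw [← h]
    exact le_csSup hbdd (Or.inr ⟨x0, c0, rfl⟩)
  · intro h
    refine IsGreatest.csSup_eq ⟨Or.inl rfl, ?_⟩
    rintro _ (rfl | ⟨x0, c0, rfl⟩)
    · exact le_rfl
    · exact h x0 c0

theorem add_le_of_intCast_eq {e : ℕ} {x y : ℤ} (h : (x : ZMod e) = y) (hxy : x < y) :
    x + e ≤ y := by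
  have := Int.le_of_dvd (by omega) ((ZMod.intCast_eq_intCast_iff_dvd_sub x y e).1 h)
  omega

/-- A suffix starting at an arbitrary content is a suffix starting at a content of residue `i`. -/
theorem exists_suffE_eq {e : ℕ} (he : 0 < e) (i : ZMod e) (x0 : ℤ) (c0 : Fin l) :
    ∃ (x1 : ℤ) (c1 : Fin l), (x1 : ZMod e) = i ∧
      ∀ (P : MP l) (s : Charge l), suffE e P s i x0 c0 = suffE e P s i x1 c1 := by
  by_cases hx0 : (x0 : ZMod e) = i
  · exact ⟨x0, c0, hx0, fun _ _ => rfl⟩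
  have : NeZero e := ⟨he.ne'⟩
  have : NeZero l := ⟨c0.pos.ne'⟩
  set n := (i - x0 : ZMod e).val with hn
  have hne : n < e := ZMod.val_lt _
  have hcast : ((x0 + n : ℤ) : ZMod e) = i := by
    push_cast
    rw [hn, ZMod.natCast_zmod_val]
    ring
  refine ⟨x0 + n, ⊤, hcast, fun P s => ?_⟩
  rw [suffE_eq_finsum, suffE_eq_finsum]
  refine finsum_congr fun x => ?_
  unfold suffTerm
  split_ifs with hx
  · have : suffRows x0 c0 x = suffRows (x0 + n) ⊤ x := by
      have hxx0 : x ≠ x0 := by rintro rfl; exact hx0 hx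
      have : x0 < x ↔ x0 + n ≤ x := by
        constructor
        · intro h
          by_contra! hlt
          have := add_le_of_intCast_eq (hx.trans hcast.symm) hlt
          omega
        · intro h
          omega
      ext c
      simp only [suffRows, Finset.mem_filter, Finset.mem_univ, true_and, le_top, and_true, hxx0,
        false_and, or_false, this]
      omega
    rw [this]
  · rfl

end

section

variable {l e : ℕ} {P P' : MP l} {s s' : Charge l} {k : ℤ} {per : Fin e → Fin l}

theorem DeletesToWith.rowHas_iff (h : DeletesToWith e P s k per P' s') (c : Fin l) (x : ℤ) :
    RowHas P' s' c x ↔ RowHas P s c x ∧ ¬ ∃ t : Fin e, per t = c ∧ x = k - ((t : ℕ) : ℤ) := by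
  have := Set.ext_iff.1 (h.2.2 c) x
  simpa using this

theorem DeletesToWith.beadCount_le (h : DeletesToWith e P s k per P' s') (A : Finset (Fin l))
    (x : ℤ) : beadCount P' s' A x ≤ beadCount P s A x := by
  refine Finset.sum_le_sum fun c _ => ?_
  by_cases hc : RowHas P' s' c x
  · simp [hc, ((h.rowHas_iff c x).1 hc).1]
  · simp only [hc, if_false]
    split_ifs <;> simp

theorem DeletesToWith.beadCount_of_notMem (h : DeletesToWith e P s k per P' s')
    (A : Finset (Fin l)) {x : ℤ} (hx : x ≤ k - e ∨ k < x) :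
    beadCount P' s' A x = beadCount P s A x := by
  refine Finset.sum_congr rfl fun c _ => ?_
  have : ¬ ∃ t : Fin e, per t = c ∧ x = k - ((t : ℕ) : ℤ) := by
    rintro ⟨t, -, ht⟩
    omega
  simp [h.rowHas_iff, this]

theorem DeletesToWith.beadCount_period (h : DeletesToWith e P s k per P' s')
    (A : Finset (Fin l)) (t : Fin e) :
    beadCount P' s' A (k - ((t : ℕ) : ℤ)) =
      beadCount P s A (k - ((t : ℕ) : ℤ)) - if per t ∈ A then 1 else 0 := by
  rw [← Finset.sum_ite_eq A (per t) (fun _ => (1 : ℤ)), beadCount, beadCount,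
    ← Finset.sum_sub_distrib]
  refine Finset.sum_congr rfl fun c _ => ?_
  have : (∃ t' : Fin e, per t' = c ∧ k - ((t : ℕ) : ℤ) = k - ((t' : ℕ) : ℤ)) ↔ per t = c := by
    constructor
    · rintro ⟨t', rfl, ht⟩
      rw [show t = t' from Fin.ext (by omega)]
    · exact fun hc => ⟨t, hc, rfl⟩
  rw [h.rowHas_iff, this]
  by_cases hc : per t = c
  · subst hc
    simp [(h.1.2.2 t).1]
  · simp [hc]

theorem DeletesToWith.beadCount_univ (h : DeletesToWith e P s k per P' s') {x : ℤ}
    (h1 : k - e < x) (h2 : x ≤ k) :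
    beadCount P' s' Finset.univ x = beadCount P s Finset.univ x - 1 := by
  have := h.beadCount_period Finset.univ ⟨(k - x).toNat, by omega⟩
  rw [show k - (((k - x).toNat : ℕ) : ℤ) = x by omega] at this
  simpa using this

theorem DeletesToWith.beadCount_eq_zero_of_lt (h : DeletesToWith e P s k per P' s')
    (A : Finset (Fin l)) {x : ℤ} (hx : k < x) : beadCount P s A x = 0 :=
  beadCount_eq_zero fun c _ hc => by have := h.1.1.2 c x hc; omega

theorem DeletesToWith.beadCount_eq_zero_of_period (h : DeletesToWith e P s k per P' s')
    {A : Finset (Fin l)} {t : Fin e} (hA : ∀ c ∈ A, c < per t) :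
    beadCount P s A (k - ((t : ℕ) : ℤ)) = 0 :=
  beadCount_eq_zero fun c hc hr => ((h.1.2.2 t).2 c hr).not_gt (hA c hc)

theorem DeletesToWith.suffTerm_eq_zero (h : DeletesToWith e P s k per P' s') (i : ZMod e)
    {x0 x : ℤ} (c0 : Fin l) (hx : x < x0 ∨ k < x) :
    suffTerm e P s i x0 c0 x = 0 ∧ suffTerm e P' s' i x0 c0 x = 0 := by
  unfold suffTerm
  rcases hx with hx | hx
  · simp [suffRows_of_gt c0 hx, beadCount_empty]
  · have hx' := hx.trans (lt_add_one x)
    simp [h.beadCount_of_notMem _ (.inr hx), h.beadCount_of_notMem _ (.inr hx'),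
      h.beadCount_eq_zero_of_lt _ hx, h.beadCount_eq_zero_of_lt _ hx']

theorem suffTerm_of_residue {i : ZMod e} {x : ℤ} (hx : (x : ZMod e) = i) (x0 : ℤ) (c0 : Fin l) :
    suffTerm e P s i x0 c0 x =
      beadCount P s (suffRows x0 c0 x) (x + 1) - beadCount P s (suffRows x0 c0 x) x :=
  if_pos hx

theorem suffTerm_of_lt_add {i : ZMod e} {x0 x : ℤ} (hx0 : (x0 : ZMod e) = i) (c0 : Fin l)
    (h : x0 < x) (hx : x < x0 + e) : suffTerm e P s i x0 c0 x = 0 := by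
  refine if_neg fun hxi => ?_
  have := add_le_of_intCast_eq (hx0.trans hxi.symm) h
  omega

theorem DeletesToWith.suffE_eq_of_lt (h : DeletesToWith e P s k per P' s')
    (hP : IsLPartition P) (he : 0 < e) (i : ZMod e) {x0 : ℤ} (c0 : Fin l) (hlt : x0 < k - e) :
    suffE e P' s' i x0 c0 = suffE e P s i x0 c0 := by
  have hterm : ∀ x, suffTerm e P' s' i x0 c0 x - suffTerm e P s i x0 c0 x =
      if (k : ZMod e) = i then (if x = k then 1 else 0) - (if x = k - e then 1 else 0)
      else 0 := by
    intro x
    by_cases hxi : (x : ZMod e) = i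
    · rw [suffTerm_of_residue hxi, suffTerm_of_residue hxi]
      rcases lt_or_ge x0 x with hx | hx
      · rw [suffRows_of_lt c0 hx]
        rcases lt_trichotomy x (k - e) with h1 | h1 | h1
        · rw [h.beadCount_of_notMem _ (x := x) (by omega),
            h.beadCount_of_notMem _ (x := x + 1) (by omega), if_neg (by omega : x ≠ k),
            if_neg (by omega : x ≠ k - e)]
          simp
        · have hk : (k : ZMod e) = i := by rw [← hxi, h1]; simp
          rw [h.beadCount_of_notMem _ (x := x) (by omega),
            h.beadCount_univ (x := x + 1) (by omega) (by omega), if_neg (by omega : x ≠ k),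
            if_pos h1, if_pos hk]
          ring
        · rcases lt_trichotomy x k with h2 | h2 | h2
          · rw [h.beadCount_univ (x := x) (by omega) (by omega),
              h.beadCount_univ (x := x + 1) (by omega) (by omega), if_neg (by omega : x ≠ k),
              if_neg (by omega : x ≠ k - e)]
            simp
          · have hk : (k : ZMod e) = i := by rw [← hxi, h2]
            rw [h.beadCount_univ (x := x) (by omega) (by omega),
              h.beadCount_of_notMem _ (x := x + 1) (by omega), if_neg (by omega : x ≠ k - e),
              if_pos h2, if_pos hk]
            ring
          · rw [h.beadCount_of_notMem _ (x := x) (by omega),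
              h.beadCount_of_notMem _ (x := x + 1) (by omega), if_neg (by omega : x ≠ k),
              if_neg (by omega : x ≠ k - e)]
            simp
      · rw [h.beadCount_of_notMem _ (x := x) (by omega),
          h.beadCount_of_notMem _ (x := x + 1) (by omega), if_neg (by omega : x ≠ k),
          if_neg (by omega : x ≠ k - e)]
        simp
    · simp only [suffTerm, if_neg hxi, sub_zero]
      split_ifs with hk h1 h2 h2
      · omega
      · exact absurd (by rw [h1, hk]) hxi
      · exact absurd (by rw [h2, ← hk]; simp) hxi
      · simp
      · rfl
  rw [← sub_eq_zero, suffE_eq_finsum, suffE_eq_finsum,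
    ← finsum_sub_distrib (finite_support_suffTerm h.2.1 e i x0 c0)
      (finite_support_suffTerm hP e i x0 c0), finsum_congr hterm]
  split_ifs
  · rw [finsum_eq_sum_of_support_subset (s := {k, k - (e : ℤ)})]
    · rw [Finset.sum_pair (by omega), if_pos rfl, if_neg (by omega), if_neg (by omega), if_pos rfl]
      ring
    · intro x hx
      by_contra hn
      simp only [Finset.coe_pair, Set.mem_insert_iff, Set.mem_singleton_iff, not_or] at hn
      simp [hn] at hx
  · simp

theorem DeletesToWith.suffE_le_and_of_residue (h : DeletesToWith e P s k per P' s')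
    (hP : IsLPartition P) (he : 0 < e) {i : ZMod e} {x0 : ℤ} (c0 : Fin l)
    (hx0 : (x0 : ZMod e) = i) :
    suffE e P s i x0 c0 ≤ suffE e P' s' i x0 c0 ∧
      (suffE e P' s' i x0 c0 = suffE e P s i x0 c0 ∨ suffE e P' s' i x0 c0 ≤ 0) := by
  have hnn' := fun A x => beadCount_nonneg (P := P') (s := s') A x
  rcases lt_trichotomy x0 (k - e) with hlt | heq | hgt
  · have := h.suffE_eq_of_lt hP he i c0 hlt
    exact ⟨this.ge, Or.inl this⟩
  · have hsupp : ∀ x, x ≠ x0 ∧ x ≠ k →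
        suffTerm e P s i x0 c0 x = 0 ∧ suffTerm e P' s' i x0 c0 x = 0 := by
      intro x hx
      by_cases hx' : x0 < x ∧ x < k
      · exact ⟨suffTerm_of_lt_add hx0 c0 hx'.1 (by omega),
          suffTerm_of_lt_add hx0 c0 hx'.1 (by omega)⟩
      · exact h.suffTerm_eq_zero i c0 (by omega)
    have hS : ∀ {Q : MP l} {r : Charge l}, (∀ x, x ≠ x0 ∧ x ≠ k → suffTerm e Q r i x0 c0 x = 0) →
        suffE e Q r i x0 c0 = suffTerm e Q r i x0 c0 x0 + suffTerm e Q r i x0 c0 k := by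
      intro Q r hQ
      rw [suffE_eq_finsum, finsum_eq_sum_of_support_subset (s := {x0, k}),
        Finset.sum_pair (by omega)]
      intro x hx
      by_contra hn
      simp only [Finset.coe_pair, Set.mem_insert_iff, Set.mem_singleton_iff, not_or] at hn
      exact hx (hQ x hn)
    have hk : (k : ZMod e) = i := by rw [← hx0, heq]; simp
    rw [hS fun x hx => (hsupp x hx).1, hS fun x hx => (hsupp x hx).2, suffTerm_of_residue hx0,
      suffTerm_of_residue hx0, suffTerm_of_residue hk, suffTerm_of_residue hk,
      suffRows_of_lt c0 (by omega : x0 < k)]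
    have h1 := h.beadCount_univ (x := k) (by omega) le_rfl
    have h2 := h.beadCount_of_notMem Finset.univ (x := k + 1) (by omega)
    have h3 := h.beadCount_eq_zero_of_lt Finset.univ (lt_add_one k)
    have h4 := h.beadCount_of_notMem (suffRows x0 c0 x0) (x := x0) (by omega)
    have h5 := h.beadCount_period (suffRows x0 c0 x0) ⟨e - 1, by omega⟩
    have h6 := h.beadCount_eq_zero_of_period (A := suffRows x0 c0 x0) (t := ⟨e - 1, by omega⟩)
    simp only [show k - ((e - 1 : ℕ) : ℤ) = x0 + 1 by omega] at h5 h6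
    have h7 := hnn' Finset.univ k
    have h8 := hnn' (suffRows x0 c0 x0) x0
    split_ifs at h5 with hmem
    · omega
    · rw [mem_suffRows_self, not_le] at hmem
      have h9 := h6 fun c hc => (mem_suffRows_self.1 hc).trans_lt hmem
      omega
  · have hsupp : ∀ x, x ≠ x0 →
        suffTerm e P s i x0 c0 x = 0 ∧ suffTerm e P' s' i x0 c0 x = 0 := by
      intro x hx
      by_cases hx' : x0 < x ∧ x ≤ k
      · exact ⟨suffTerm_of_lt_add hx0 c0 hx'.1 (by omega),
          suffTerm_of_lt_add hx0 c0 hx'.1 (by omega)⟩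
      · exact h.suffTerm_eq_zero i c0 (by omega)
    rw [suffE_eq_finsum, suffE_eq_finsum, finsum_eq_single _ x0 fun x hx => (hsupp x hx).1,
      finsum_eq_single _ x0 fun x hx => (hsupp x hx).2, suffTerm_of_residue hx0,
      suffTerm_of_residue hx0]
    have h1 := hnn' (suffRows x0 c0 x0) x0
    rcases le_or_gt k x0 with hk | hk
    · have h2 := h.beadCount_of_notMem (suffRows x0 c0 x0) (x := x0 + 1) (by omega)
      have h3 := h.beadCount_eq_zero_of_lt (suffRows x0 c0 x0) (by omega : k < x0 + 1)
      have h4 := h.beadCount_le (suffRows x0 c0 x0) x0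
      omega
    · set t : Fin e := ⟨(k - x0).toNat, by omega⟩ with ht
      set t' : Fin e := ⟨(k - x0 - 1).toNat, by omega⟩ with ht'
      have hper : per t ≤ per t' := h.1.2.1 (by rw [ht, ht', Fin.mk_le_mk]; omega)
      have h2 := h.beadCount_period (suffRows x0 c0 x0) t
      have h3 := h.beadCount_period (suffRows x0 c0 x0) t'
      have h4 := h.beadCount_eq_zero_of_period (A := suffRows x0 c0 x0) (t := t')
      rw [show k - ((t : ℕ) : ℤ) = x0 by simp only [ht]; omega] at h2
      rw [show k - ((t' : ℕ) : ℤ) = x0 + 1 by simp only [ht']; omega] at h3 h4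
      simp only [mem_suffRows_self] at h2 h3 h4
      by_cases hc' : per t' ≤ c0
      · rw [if_pos hc'] at h3
        rw [if_pos (hper.trans hc')] at h2
        omega
      · have h5 := h4 fun c hc => hc.trans_lt (not_le.1 hc')
        rw [if_neg hc'] at h3
        split_ifs at h2 <;> omega

theorem DeletesToWith.suffE_le_and (h : DeletesToWith e P s k per P' s')
    (hP : IsLPartition P) (he : 0 < e) (i : ZMod e) (x0 : ℤ) (c0 : Fin l) :
    suffE e P s i x0 c0 ≤ suffE e P' s' i x0 c0 ∧
      (suffE e P' s' i x0 c0 = suffE e P s i x0 c0 ∨ suffE e P' s' i x0 c0 ≤ 0) := by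
  obtain ⟨x1, c1, hx1, heq⟩ := exists_suffE_eq he i x0 c0
  rw [heq P s, heq P' s']
  exact h.suffE_le_and_of_residue hP he c1 hx1

end

/-- `ε_i(λ) = 0` if and only if `ε_i(λ⁻) = 0`. -/
theorem eps_zero_iff_of_deleteStep {l e : ℕ} (hl : 0 < l) (he : 2 ≤ e)
    (P : MP l) (s : Charge l) (hP : IsLPartition P)
    (P' : MP l) (s' : Charge l) (h : DeleteStep e P s P' s') :
    ∀ i : ZMod e, (epsE e P s i = 0 ↔ epsE e P' s' i = 0) := by
  intro i
  rcases h with ⟨-, rfl, rfl⟩ | ⟨k, per, h⟩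
  · rfl
  have hsuff := h.suffE_le_and hP (by omega) i
  rw [epsE_eq_zero_iff hP, epsE_eq_zero_iff h.2.1]
  refine ⟨fun h0 x0 c0 => ?_, fun h0 x0 c0 => (hsuff x0 c0).1.trans (h0 x0 c0)⟩
  rcases (hsuff x0 c0).2 with heq | hle
  · exact heq.trans_le (h0 x0 c0)
  · exact hle

end FockHW
end
end

section
/- For any s ∈ ℤ^l there exists an integer p ≥ 0 such that s^{(p)} ∈ T_{l,e}, where s^{(0)} = s and, as long as s^{(p)} ∉ T_{l,e}, s^{(p+1)} = (s^{(p)})′ is the multicharge obtained by deleting the e-period of the symbol B(∅, s^{(p)}) of the empty l-partition. -/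
/- Formalization of combinatorial notions from
   "A combinatorial decomposition of higher level Fock spaces"
   by N. Jacon and C. Lecouvey. -/

open scoped Classical

noncomputable section

namespace FockHW

theorem rowHas_emptyMP {l : ℕ} (s : Charge l) (c : Fin l) (v : ℤ) :
    RowHas (emptyMP l) s c v ↔ v ≤ s c := by
  unfold RowHas symb emptyMP
  constructor
  · rintro ⟨i, rfl⟩
    push_cast
    omega
  · intro h
    refine ⟨(s c - v).toNat, ?_⟩
    push_cast
    omega

theorem isLPartition_emptyMP (l : ℕ) : IsLPartition (emptyMP l) :=
  ⟨fun _ _ _ _ => le_rfl, fun _ => ⟨0, fun _ _ => rfl⟩⟩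

/-- The running maximum `max(x, S 0, …, S (n-1))`. -/
def runMax (x : ℤ) (S : ℕ → ℤ) : ℕ → ℤ
  | 0 => x
  | n + 1 => max (S n) (runMax x S n)

/-- Insert `x` in front of `S` and perform one bubble sort pass; deleting the `e`-period of
the symbol with largest entry `k` amounts to this operation with `x = k - e`. -/
def bubble (x : ℤ) (S : ℕ → ℤ) : ℕ → ℤ := fun n => min (S n) (runMax x S n)

theorem le_runMax_iff (x : ℤ) (S : ℕ → ℤ) (v : ℤ) (n : ℕ) :
    v ≤ runMax x S n ↔ v ≤ x ∨ ∃ c < n, v ≤ S c := by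
  induction n with
  | zero => simp [runMax]
  | succ n ih =>
    simp only [runMax, le_max_iff, ih, Nat.lt_succ_iff_lt_or_eq]
    constructor
    · rintro (h | h | ⟨c, hc, h⟩)
      · exact Or.inr ⟨n, Or.inr rfl, h⟩
      · exact Or.inl h
      · exact Or.inr ⟨c, Or.inl hc, h⟩
    · rintro (h | ⟨c, hc | rfl, h⟩)
      · exact Or.inr (Or.inl h)
      · exact Or.inr (Or.inr ⟨c, hc, h⟩)
      · exact Or.inl h

theorem runMax_eq_of_isMax {l : ℕ} {x k : ℤ} {S : ℕ → ℤ} (hx : x ≤ k)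
    (hk : ∃ c < l, S c = k) (hmax : ∀ c < l, S c ≤ k) : runMax x S l = k := by
  refine le_antisymm ?_ ?_
  · rcases (le_runMax_iff x S _ l).1 le_rfl with h | ⟨c, hc, h⟩
    · exact h.trans hx
    · exact h.trans (hmax c hc)
  · obtain ⟨c, hc, h⟩ := hk
    exact (le_runMax_iff x S k l).2 (Or.inr ⟨c, hc, h.ge⟩)

theorem deletesTo_bubble {l e : ℕ} {S : ℕ → ℤ} {k : ℤ}
    (hk : ∃ c < l, S c = k) (hmax : ∀ c < l, S c ≤ k) :
    DeletesTo e (emptyMP l) (fun c : Fin l => S c) (emptyMP l)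
      (fun c : Fin l => bubble (k - e) S c) := by
  obtain ⟨c₀, hc₀, hS⟩ := hk
  have hex : ∀ t : Fin e, ∃ n, n < l ∧ k - ((t : ℕ) : ℤ) ≤ S n :=
    fun t => ⟨c₀, hc₀, by omega⟩
  refine ⟨k, fun t => ⟨Nat.find (hex t), (Nat.find_spec (hex t)).1⟩,
    ⟨⟨⟨⟨c₀, hc₀⟩, ?_⟩, ?_⟩, ?_, ?_⟩, isLPartition_emptyMP l, ?_⟩
  · rw [rowHas_emptyMP]
    exact hS.ge
  · intro c v h
    rw [rowHas_emptyMP] at h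
    exact h.trans (hmax c c.2)
  · intro t u htu
    have htu' : (t : ℕ) ≤ u := htu
    obtain ⟨hl, h⟩ := Nat.find_spec (hex t)
    exact Nat.find_min' (hex u) ⟨hl, le_trans (by omega) h⟩
  · intro t
    refine ⟨?_, fun d hd => ?_⟩
    · rw [rowHas_emptyMP]
      exact (Nat.find_spec (hex t)).2
    · rw [rowHas_emptyMP] at hd
      exact Nat.find_min' (hex t) ⟨d.2, hd⟩
  · intro d
    ext v
    simp only [Set.mem_ofPred_eq, Set.mem_sdiff, rowHas_emptyMP, bubble, le_min_iff,
      le_runMax_iff]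
    refine and_congr_right fun hv => ⟨?_, ?_⟩
    · rintro h ⟨t, rfl, rfl⟩
      have ht := t.2
      rcases h with h | ⟨c, hc, h⟩
      · omega
      · have hcl : c < l := hc.trans (Nat.find_spec (hex t)).1
        exact Nat.find_min (hex t) hc ⟨hcl, h⟩
    · intro h
      by_contra! hcon
      have hdk := hmax d d.2
      refine h ⟨⟨(k - v).toNat, by omega⟩, ?_, ?_⟩
      · apply Fin.ext
        refine (Nat.find_eq_iff _).2 ⟨⟨d.2, ?_⟩, fun c hc hcon' => ?_⟩
        · simp only
          omega
        · have := hcon.2 c hc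
          simp only at hcon'
          omega
      · simp only
        omega

theorem sum_bubble_add (x : ℤ) (S : ℕ → ℤ) (g : ℤ → ℤ) (n : ℕ) :
    ∑ i ∈ Finset.range n, g (bubble x S i) + g (runMax x S n) =
      ∑ i ∈ Finset.range n, g (S i) + g x := by
  induction n with
  | zero => simp [runMax]
  | succ n ih =>
    rw [Finset.sum_range_succ, Finset.sum_range_succ]
    simp only [runMax, bubble] at ih ⊢
    rcases le_total (S n) (runMax x S n) with h | h
    · rw [min_eq_left h, max_eq_right h]
      linarith
    · rw [min_eq_right h, max_eq_left h]
      linarith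

/-- The quadratic form `∑_{i<j<n} (S i - S j)(S i - S j + e)`. -/
def energy (e : ℤ) (S : ℕ → ℤ) (n : ℕ) : ℤ :=
  ∑ j ∈ Finset.range n, ∑ i ∈ Finset.range j, (S i - S j) * (S i - S j + e)

theorem energy_bubble_add (e x : ℤ) (S : ℕ → ℤ) (n : ℕ) :
    energy e (bubble x S) n +
        ∑ j ∈ Finset.range n,
          (bubble x S j - runMax x S n) * (bubble x S j - runMax x S n + e) =
      energy e S n + ∑ j ∈ Finset.range n, (x - S j) * (x - S j + e) -
        2 * e * ∑ d ∈ Finset.range n, max (runMax x S d - S d) 0 := by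
  induction n with
  | zero => simp [energy]
  | succ n ih =>
    have key := sum_bubble_add x S (fun y => (y - S n) * (y - S n + e)) n
    simp only [energy] at ih ⊢
    simp only [Finset.sum_range_succ _ n]
    have hb : bubble x S n = min (S n) (runMax x S n) := rfl
    have hr : runMax x S (n + 1) = max (S n) (runMax x S n) := rfl
    rcases le_total (S n) (runMax x S n) with h | h
    · rw [min_eq_left h] at hb
      rw [max_eq_right h] at hr
      rw [hb, hr, max_eq_left (sub_nonneg.2 h)]
      linear_combination ih + key
    · rw [min_eq_right h] at hb
      rw [max_eq_left h] at hr
      rw [hb, hr, max_eq_right (sub_nonpos.2 h)]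
      linear_combination ih + key

theorem energy_bubble {l : ℕ} {e k : ℤ} {S : ℕ → ℤ} (he : 0 ≤ e)
    (hk : ∃ c < l, S c = k) (hmax : ∀ c < l, S c ≤ k) :
    energy e (bubble (k - e) S) l =
      energy e S l - 2 * e * ∑ d ∈ Finset.range l, max (runMax (k - e) S d - S d) 0 := by
  have h := energy_bubble_add e (k - e) S l
  have hs := sum_bubble_add (k - e) S (fun y => (y - k) * (y - k + e)) l
  rw [runMax_eq_of_isMax (by omega) hk hmax] at h hs
  have hc : ∑ j ∈ Finset.range l, (k - e - S j) * (k - e - S j + e) =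
      ∑ j ∈ Finset.range l, (S j - k) * (S j - k + e) :=
    Finset.sum_congr rfl fun j _ => by ring
  rw [hc] at h
  linear_combination h - hs

theorem energy_lower_bound (e : ℤ) (S : ℕ → ℤ) (n : ℕ) :
    -∑ j ∈ Finset.range n, ∑ _i ∈ Finset.range j, e ^ 2 ≤ energy e S n := by
  rw [energy, ← Finset.sum_neg_distrib]
  refine Finset.sum_le_sum fun j _ => ?_
  rw [← Finset.sum_neg_distrib]
  exact Finset.sum_le_sum fun i _ => by
    nlinarith [sq_nonneg (2 * (S i - S j) + e), sq_nonneg e]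

/-- The total of the differences `S d - S 0` over `d < n`. -/
def excess (S : ℕ → ℤ) (n : ℕ) : ℤ := ∑ d ∈ Finset.range n, (S d - S 0)

/-- Iterated deletion of `e`-periods from `B(∅,s)` reaches `T_{l,e}`. -/
def ReachesTle {l : ℕ} (e : ℕ) (s : Charge l) : Prop :=
  ∃ (p : ℕ) (g : ℕ → Charge l), g 0 = s ∧
    (∀ m, m < p → g m ∉ Tle l e ∧
      DeletesTo e (emptyMP l) (g m) (emptyMP l) (g (m + 1))) ∧
    g p ∈ Tle l e

theorem ReachesTle.of_mem {l e : ℕ} {s : Charge l} (h : s ∈ Tle l e) : ReachesTle e s :=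
  ⟨0, fun _ => s, rfl, fun _ hm => absurd hm (Nat.not_lt_zero _), h⟩

theorem ReachesTle.of_deletesTo {l e : ℕ} {s s' : Charge l} (hs : s ∉ Tle l e)
    (hd : DeletesTo e (emptyMP l) s (emptyMP l) s') (h : ReachesTle e s') :
    ReachesTle e s := by
  obtain ⟨p, g, rfl, hg, hp⟩ := h
  refine ⟨p + 1, fun n => Nat.casesOn n s g, rfl, fun m hm => ?_, hp⟩
  cases m with
  | zero => exact ⟨hs, hd⟩
  | succ m => exact hg m (by omega)

theorem reachesTle_of_nat {l e : ℕ} (hl : 0 < l) (he : 0 < e) (S : ℕ → ℤ) :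
    ReachesTle e (fun c : Fin l => S c) := by
  set C : ℤ := ∑ j ∈ Finset.range l, ∑ _i ∈ Finset.range j, (e : ℤ) ^ 2 with hC
  induction hn : (energy e S l + C).toNat using Nat.strong_induction_on generalizing S with
  | _ n ihn =>
  induction hm : (excess S l).toNat using Nat.strong_induction_on generalizing S with
  | _ m ihm =>
  by_cases hT : (fun c : Fin l => S c) ∈ Tle l e
  · exact .of_mem hT
  obtain ⟨c₀, hc₀, hmax⟩ := Finset.exists_max_image (Finset.range l) S ⟨0, by simpa using hl⟩
  simp only [Finset.mem_range] at hc₀ hmax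
  obtain ⟨k, hk⟩ : ∃ k, S c₀ = k := ⟨_, rfl⟩
  rw [hk] at hmax
  have hex : ∃ c < l, S c = k := ⟨c₀, hc₀, hk⟩
  refine .of_deletesTo hT (deletesTo_bubble hex hmax) ?_
  have hE := energy_bubble (e := e) (by omega) hex hmax
  have hlow := energy_lower_bound e S l
  have hlow' := energy_lower_bound e (bubble (k - e) S) l
  have hnonneg : ∀ d ∈ Finset.range l, 0 ≤ max (runMax (k - e) S d - S d) 0 :=
    fun d _ => le_max_right _ _
  have he' : (0 : ℤ) < e := by exact_mod_cast he
  rcases (Finset.sum_nonneg hnonneg).lt_or_eq with hpos | hzero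
  · refine ihn _ ?_ _ rfl
    have := mul_pos he' hpos
    rw [← hn]
    have h2 : energy e (bubble (k - e) S) l < energy e S l := by nlinarith
    omega
  · rw [← hzero, mul_zero, sub_zero] at hE
    have hle : ∀ d < l, runMax (k - e) S d ≤ S d := by
      intro d hd
      have := (Finset.sum_eq_zero_iff_of_nonneg hnonneg).1 hzero.symm d (Finset.mem_range.2 hd)
      have := le_max_left (runMax (k - e) S d - S d) 0
      omega
    have hmono : ∀ c d, c ≤ d → d < l → S c ≤ S d := by
      intro c d hcd hd
      rcases hcd.eq_or_lt with rfl | hcd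
      · exact le_rfl
      · exact ((le_runMax_iff _ _ _ _).2 (Or.inr ⟨c, hcd, le_rfl⟩)).trans (hle d hd)
    have h0 : S 0 = k - e := by
      refine le_antisymm ?_ (hle 0 hl)
      by_contra! hlt
      refine hT ⟨fun c d hcd => hmono c d hcd d.2, fun c d => ?_⟩
      have := hmono 0 c (Nat.zero_le _) c.2
      have := hmax d d.2
      simp only
      omega
    have hb0 : bubble (k - e) S 0 = S 0 := by simp [bubble, runMax, h0]
    have hsum := sum_bubble_add (k - e) S (fun y => y - S 0) l
    rw [runMax_eq_of_isMax (by omega) hex hmax] at hsum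
    have hex' : excess (bubble (k - e) S) l = excess S l - e := by
      simp only [excess, hb0]
      omega
    have hge : k - S 0 ≤ excess S l := by
      rw [← hk]
      exact Finset.single_le_sum (f := fun d => S d - S 0)
        (fun d hd => sub_nonneg.2 (hmono 0 d (Nat.zero_le _) (Finset.mem_range.1 hd)))
        (Finset.mem_range.2 hc₀)
    exact ihm _ (by omega) _ (by rw [hE, hn]) rfl

/-- iterated deletion of `e`-periods in the symbol of the empty
`l`-partition reaches a multicharge in `T_{l,e}` after finitely many steps. -/
theorem empty_peeling_reaches_Tle {l e : ℕ} (hl : 0 < l) (he : 2 ≤ e) (s : Charge l) :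
    ∃ (p : ℕ) (g : ℕ → Charge l), g 0 = s ∧
      (∀ m, m < p → g m ∉ Tle l e ∧
        DeletesTo e (emptyMP l) (g m) (emptyMP l) (g (m + 1))) ∧
      g p ∈ Tle l e := by
  have h := reachesTle_of_nat hl (by omega : 0 < e) (fun n => if h : n < l then s ⟨n, h⟩ else 0)
  simpa [ReachesTle] using h

end FockHW
end
end
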